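/- For each t ∈ ℕ, let E be a finite-dimensional real inner product space, let C_t ⊆ E be nonempty, closed and convex with Euclidean projection proj_{C_t}, let α_t, β_t > 0 with α_t ≤ β_t, ε_t ≥ 0, η_t > 0, and let f_t : E × E → ℝ and g_t : E × E → E satisfy: (i) for every y, x ↦ f_t(x, y) is differentiable with gradient g_t(·, y) and is α_t-strongly convex; (ii) g_t(·, y) is β_t-Lipschitz; (iii) for every x, y ↦ g_t(x, y) is (β_t ε_t)-Lipschitz. Let x̄_t ∈ E satisfy x̄_t = proj_{C_t}(x̄_t − η_t g_t(x̄_t, x̄_t)) for every t, and let the iterates of online projected gradient descent be x_{t+1} = proj_{C_t}(x_t − η_t g_t(x_t, x_t)) from an arbitrary x_0 ∈ E. Set ρ_t = max{|1 − η_t α_t|, |1 − η_t β_t|}, λ_t = ρ_t + η_t β_t ε_t, e_t = ‖x_t − x̄_t‖ and φ_t = ‖x̄_{t+1} − x̄_t‖. Then for every t ∈ ℕ: e_{t+1} ≤ (∏_{i=0}^{t} λ_i) e_0 + φ_t + Σ_{i=0}^{t−1} (∏_{k=i+1}^{t} λ_k) φ_i. -/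

import Mathlib

open scoped RealInnerProductSpace

section

variable {E : Type*} [NormedAddCommGroup E] [InnerProductSpace ℝ E]

/-- Nearest points of a convex set satisfy the variational inequality. -/
theorem inner_sub_le_zero_of_forall_norm_le {K : Set E} (hK : Convex ℝ K) {a p : E}
    (hp : p ∈ K) (hmin : ∀ u ∈ K, ‖a - p‖ ≤ ‖a - u‖) {w : E} (hw : w ∈ K) :
    ⟪a - p, w - p⟫ ≤ 0 := by
  refine (norm_eq_iInf_iff_real_inner_le_zero hK hp).1 ?_ w hw
  have : Nonempty K := ⟨⟨p, hp⟩⟩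
  exact le_antisymm (le_ciInf fun u => hmin u u.2)
    (ciInf_le ⟨0, by rintro _ ⟨u, rfl⟩; exact norm_nonneg _⟩ (⟨p, hp⟩ : K))

/-- Taking nearest points in a convex set is nonexpansive. -/
theorem norm_sub_le_of_forall_norm_le {K : Set E} (hK : Convex ℝ K) {a b p q : E}
    (hp : p ∈ K) (hpmin : ∀ u ∈ K, ‖a - p‖ ≤ ‖a - u‖)
    (hq : q ∈ K) (hqmin : ∀ u ∈ K, ‖b - q‖ ≤ ‖b - u‖) :
    ‖p - q‖ ≤ ‖a - b‖ := by
  have h1 := inner_sub_le_zero_of_forall_norm_le hK hp hpmin hq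
  have h2 := inner_sub_le_zero_of_forall_norm_le hK hq hqmin hp
  have h3 : ‖p - q‖ ^ 2 ≤ ⟪a - b, p - q⟫ := by
    have : ‖p - q‖ ^ 2 = ⟪a - b, p - q⟫ + ⟪a - p, q - p⟫ + ⟪b - q, p - q⟫ := by
      rw [← real_inner_self_eq_norm_sq]
      simp only [inner_sub_left, inner_sub_right]
      ring
    linarith
  have h4 := real_inner_le_norm (a - b) (p - q)
  by_contra! h
  nlinarith [norm_nonneg (a - b)]

variable [CompleteSpace E]

theorem HasGradientAt.hasDerivAt_comp_add_smul {f : E → ℝ} {p x v : E} {s : ℝ}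
    (hf : HasGradientAt f p (x + s • v)) :
    HasDerivAt (fun r : ℝ => f (x + r • v)) ⟪p, v⟫ s := by
  have hl : HasDerivAt (fun r : ℝ => x + r • v) v s := by
    simpa using ((hasDerivAt_id s).smul_const v).const_add x
  have hc := hf.hasFDerivAt.comp_hasDerivAt s hl
  rw [InnerProductSpace.toDual_apply_apply] at hc
  exact hc

/-- The first-order inequality for convex functions. -/
theorem ConvexOn.add_inner_le_of_hasGradientAt {h : E → ℝ} (hc : ConvexOn ℝ Set.univ h)
    {p x : E} (hp : HasGradientAt h p x) (y : E) :
    h x + ⟪p, y - x⟫ ≤ h y := by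
  have hline : ConvexOn ℝ Set.univ (fun r : ℝ => h (x + r • (y - x))) := by
    have := hc.comp_affineMap (AffineMap.lineMap x y : ℝ →ᵃ[ℝ] E)
    simpa [Function.comp_def, AffineMap.lineMap_apply, add_comm] using this
  have hd : HasDerivAt (fun r : ℝ => h (x + r • (y - x))) ⟪p, y - x⟫ 0 :=
    HasGradientAt.hasDerivAt_comp_add_smul (by simpa using hp)
  have := hline.le_slope_of_hasDerivAt (Set.mem_univ 0) (Set.mem_univ 1) zero_lt_one hd
  simp [slope_def_field] at this
  linarith

/-- The descent lemma for functions with Lipschitz gradient. -/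
theorem le_add_inner_add_of_lipschitz_gradient {f : E → ℝ} {g : E → E} {β : ℝ}
    (hf : ∀ x, HasGradientAt f (g x) x) (hg : ∀ x y, ‖g x - g y‖ ≤ β * ‖x - y‖) (x y : E) :
    f y ≤ f x + ⟪g x, y - x⟫ + β / 2 * ‖y - x‖ ^ 2 := by
  set v := y - x with hv
  have hd : ∀ s : ℝ, HasDerivAt
      (fun r : ℝ => f (x + r • v) - r * ⟪g x, v⟫ - β / 2 * ‖v‖ ^ 2 * r ^ 2)
      (⟪g (x + s • v), v⟫ - ⟪g x, v⟫ - β / 2 * ‖v‖ ^ 2 * (2 * s)) s := fun s => by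
    have h1 := (hf (x + s • v)).hasDerivAt_comp_add_smul
    have h2 := (hasDerivAt_id s).mul_const ⟪g x, v⟫
    have h3 := (hasDerivAt_pow 2 s).const_mul (β / 2 * ‖v‖ ^ 2)
    refine ((h1.sub h2).sub h3).congr_deriv ?_
    simp
  have hanti : AntitoneOn
      (fun r : ℝ => f (x + r • v) - r * ⟪g x, v⟫ - β / 2 * ‖v‖ ^ 2 * r ^ 2) (Set.Icc 0 1) := by
    refine antitoneOn_of_deriv_nonpos (convex_Icc 0 1)
      (fun s _ => (hd s).continuousAt.continuousWithinAt)
      (fun s _ => (hd s).differentiableAt.differentiableWithinAt) fun s hs => ?_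
    rw [interior_Icc] at hs
    rw [(hd s).deriv, ← inner_sub_left]
    have h1 := real_inner_le_norm (g (x + s • v) - g x) v
    have h2 := hg (x + s • v) x
    rw [add_sub_cancel_left, norm_smul, Real.norm_of_nonneg hs.1.le] at h2
    nlinarith [mul_le_mul_of_nonneg_right h2 (norm_nonneg v)]
  have := hanti (Set.left_mem_Icc.2 zero_le_one) (Set.right_mem_Icc.2 zero_le_one) zero_le_one
  simp [hv] at this
  linarith

/-- Cocoercivity of the gradient of a convex function with a quadratic upper bound. -/
theorem ConvexOn.norm_sub_sq_le_mul_inner {h : E → ℝ} {p : E → E} {L : ℝ} (hL : 0 ≤ L)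
    (hc : ConvexOn ℝ Set.univ h) (hp : ∀ x, HasGradientAt h (p x) x)
    (hub : ∀ x y, h y ≤ h x + ⟪p x, y - x⟫ + L / 2 * ‖y - x‖ ^ 2) (x y : E) :
    ‖p y - p x‖ ^ 2 ≤ L * ⟪p y - p x, y - x⟫ := by
  have key : ∀ s : ℝ, (2 * s - L * s ^ 2) * ‖p y - p x‖ ^ 2 ≤ ⟪p y - p x, y - x⟫ := fun s => by
    have h1 := (hc.add_inner_le_of_hasGradientAt (hp y) (x + s • (p y - p x))).trans (hub x _)
    have h2 := (hc.add_inner_le_of_hasGradientAt (hp x) (y - s • (p y - p x))).trans (hub y _)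
    simp only [add_sub_cancel_left, sub_sub_cancel_left, norm_neg, norm_smul, mul_pow,
      Real.norm_eq_abs, sq_abs, ← real_inner_self_eq_norm_sq, inner_sub_left, inner_sub_right,
      inner_add_right, inner_neg_right, real_inner_smul_right] at h1 h2 ⊢
    linarith
  rcases hL.eq_or_lt with rfl | hL
  · by_contra! hlt
    rw [zero_mul] at hlt
    have := key ((|⟪p y - p x, y - x⟫| + 1) / (2 * ‖p y - p x‖ ^ 2))
    rw [zero_mul, sub_zero, mul_right_comm, mul_div_cancel₀ _ (by positivity)] at this
    linarith [le_abs_self ⟪p y - p x, y - x⟫]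
  · have := key L⁻¹
    have he : 2 * L⁻¹ - L * L⁻¹ ^ 2 = L⁻¹ := by field_simp; ring
    rwa [he, inv_mul_le_iff₀ hL] at this

/-- A gradient step on an `α`-strongly convex function with `β`-Lipschitz gradient is Lipschitz
with constant `max |1 - η α| |1 - η β|`. -/
theorem norm_gradient_step_sub_le {f : E → ℝ} {g : E → E} {α β η : ℝ} (hαβ : α ≤ β)
    (hf : ∀ x, HasGradientAt f (g x) x)
    (hc : ConvexOn ℝ Set.univ (fun x => f x - α / 2 * ‖x‖ ^ 2))
    (hg : ∀ x y, ‖g x - g y‖ ≤ β * ‖x - y‖) (x y : E) :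
    ‖(y - η • g y) - (x - η • g x)‖ ≤ max |1 - η * α| |1 - η * β| * ‖y - x‖ := by
  have hp : ∀ z, HasGradientAt (fun x => f x - α / 2 * ‖x‖ ^ 2) (g z - α • z) z := fun z => by
    have h1 := (hf z).hasFDerivAt.sub ((hasStrictFDerivAt_norm_sq z).hasFDerivAt.const_mul (α / 2))
    rw [hasGradientAt_iff_hasFDerivAt]
    refine h1.congr_fderiv ?_
    ext w
    simp
    ring
  have hco := hc.norm_sub_sq_le_mul_inner (sub_nonneg.2 hαβ) hp (fun a b => by
    have := le_add_inner_add_of_lipschitz_gradient hf hg a b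
    simp only [norm_sub_sq_real, inner_sub_left, inner_sub_right, real_inner_smul_left,
      real_inner_self_eq_norm_sq, real_inner_comm b a] at this ⊢
    linarith) x y
  set v := y - x with hv
  set d := g y - g x with hd
  have hw : g y - α • y - (g x - α • x) = d - α • v := by
    rw [hv, hd, smul_sub]; abel
  have hs : (y - η • g y) - (x - η • g x) = v - η • d := by
    rw [hv, hd, smul_sub]; abel
  rw [hw] at hco
  rw [hs]
  have hup : ⟪d, v⟫ ≤ β * ‖v‖ ^ 2 := by
    nlinarith [real_inner_le_norm d v, mul_le_mul_of_nonneg_right (hg y x) (norm_nonneg v)]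
  have hlow : α * ‖v‖ ^ 2 ≤ ⟪d, v⟫ := by
    have h1 := hc.add_inner_le_of_hasGradientAt (hp x) y
    have h2 := hc.add_inner_le_of_hasGradientAt (hp y) x
    have h3 : ⟪g y - α • y, x - y⟫ + ⟪g x - α • x, y - x⟫ = α * ‖v‖ ^ 2 - ⟪d, v⟫ := by
      rw [hv, hd, ← real_inner_self_eq_norm_sq]
      simp only [inner_sub_left, inner_sub_right, real_inner_smul_left]
      ring
    linarith
  have hd2 : ‖d‖ ^ 2 ≤ (α + β) * ⟪d, v⟫ - α * β * ‖v‖ ^ 2 := by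
    rw [norm_sub_sq_real, norm_smul, mul_pow, Real.norm_eq_abs, sq_abs, real_inner_smul_right,
      inner_sub_left d, real_inner_smul_left, real_inner_self_eq_norm_sq] at hco
    linarith
  have hexp : ‖v - η • d‖ ^ 2 = ‖v‖ ^ 2 - 2 * η * ⟪d, v⟫ + η ^ 2 * ‖d‖ ^ 2 := by
    rw [norm_sub_sq_real, norm_smul, mul_pow, Real.norm_eq_abs, sq_abs, real_inner_smul_right,
      real_inner_comm]
    ring
  set ρ := max |1 - η * α| |1 - η * β| with hρ
  have hρ0 : 0 ≤ ρ := (abs_nonneg _).trans (le_max_left _ _)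
  have hρα : (1 - η * α) ^ 2 ≤ ρ ^ 2 := sq_le_sq' (neg_le_of_abs_le (le_max_left _ _))
    (le_of_abs_le (le_max_left _ _))
  have hρβ : (1 - η * β) ^ 2 ≤ ρ ^ 2 := sq_le_sq' (neg_le_of_abs_le (le_max_right _ _))
    (le_of_abs_le (le_max_right _ _))
  refine le_of_sq_le_sq ?_ (mul_nonneg hρ0 (norm_nonneg v))
  rw [hexp, mul_pow]
  have hd3 := mul_le_mul_of_nonneg_left hd2 (sq_nonneg η)
  have hvα := mul_le_mul_of_nonneg_right hρα (sq_nonneg ‖v‖)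
  have hvβ := mul_le_mul_of_nonneg_right hρβ (sq_nonneg ‖v‖)
  rcases le_total (η ^ 2 * (α + β) - 2 * η) 0 with hk | hk
  · nlinarith [mul_le_mul_of_nonpos_left hlow hk]
  · nlinarith [mul_le_mul_of_nonneg_left hup hk]

end

/-- The discrete Grönwall inequality with variable coefficients. -/
theorem le_prod_mul_add_sum_of_le_mul_add {e c φ : ℕ → ℝ} (hc : ∀ t, 0 ≤ c t)
    (h : ∀ t, e (t + 1) ≤ c t * e t + φ t) (t : ℕ) :
    e (t + 1) ≤ (∏ i ∈ Finset.range (t + 1), c i) * e 0 + φ t +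
      ∑ i ∈ Finset.range t, (∏ k ∈ Finset.Ico (i + 1) (t + 1), c k) * φ i := by
  induction t with
  | zero => simpa using h 0
  | succ t ih =>
    refine (h (t + 1)).trans ((add_le_add_left (mul_le_mul_of_nonneg_left ih (hc _)) _).trans_eq ?_)
    have hsum : ∑ i ∈ Finset.range t, (∏ k ∈ Finset.Ico (i + 1) (t + 1 + 1), c k) * φ i =
        c (t + 1) * ∑ i ∈ Finset.range t, (∏ k ∈ Finset.Ico (i + 1) (t + 1), c k) * φ i := by
      rw [Finset.mul_sum]
      refine Finset.sum_congr rfl fun i hi => ?_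
      rw [Finset.prod_Ico_succ_top (by have := Finset.mem_range.1 hi; omega)]
      ring
    rw [Finset.sum_range_succ, hsum, Finset.prod_range_succ _ (t + 1),
      Finset.prod_Ico_succ_top le_rfl, Finset.Ico_self, Finset.prod_empty]
    ring


/-- Tracking error of online projected gradient descent (Theorem 1 of the paper):
with `λ_t = max{|1 − η_t α_t|, |1 − η_t β_t|} + η_t β_t ε_t`, the tracking error
`e_t = ‖x_t − x̄_t‖` relative to the performatively stable points `x̄_t` satisfies
`e_{t+1} ≤ (∏_{i=0}^t λ_i) e_0 + φ_t + Σ_{i=0}^{t-1} (∏_{k=i+1}^t λ_k) φ_i`,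
where `φ_t = ‖x̄_{t+1} − x̄_t‖` is the temporal drift. -/
theorem opgd_tracking_error
    {E : Type*} [NormedAddCommGroup E] [InnerProductSpace ℝ E]
    [FiniteDimensional ℝ E]
    (C : ℕ → Set E) (hCne : ∀ t, (C t).Nonempty)
    (hCclosed : ∀ t, IsClosed (C t)) (hCconv : ∀ t, Convex ℝ (C t))
    (proj : ℕ → E → E)
    (hproj : ∀ t x, proj t x ∈ C t ∧ ∀ u ∈ C t, ‖x - proj t x‖ ≤ ‖x - u‖)
    (f : ℕ → E → E → ℝ) (g : ℕ → E → E → E) (α β ε η : ℕ → ℝ)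
    (hα : ∀ t, 0 < α t) (hαβ : ∀ t, α t ≤ β t) (hε : ∀ t, 0 ≤ ε t)
    (hη : ∀ t, 0 < η t)
    (hgrad : ∀ t y x, HasGradientAt (fun x' => f t x' y) (g t x y) x)
    (hsc : ∀ t y, ConvexOn ℝ Set.univ (fun x => f t x y - α t / 2 * ‖x‖ ^ 2))
    (hglip : ∀ t y x x', ‖g t x y - g t x' y‖ ≤ β t * ‖x - x'‖)
    (hsens : ∀ t x y y', ‖g t x y - g t x y'‖ ≤ β t * ε t * ‖y - y'‖)
    (xb : ℕ → E) (hxb : ∀ t, xb t = proj t (xb t - η t • g t (xb t) (xb t)))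
    (x : ℕ → E) (hx : ∀ t, x (t + 1) = proj t (x t - η t • g t (x t) (x t))) :
    ∀ t : ℕ,
      ‖x (t + 1) - xb (t + 1)‖ ≤
        (∏ i ∈ Finset.range (t + 1),
            (max |1 - η i * α i| |1 - η i * β i| + η i * β i * ε i)) *
          ‖x 0 - xb 0‖ +
        ‖xb (t + 1) - xb t‖ +
        ∑ i ∈ Finset.range t,
          (∏ k ∈ Finset.Ico (i + 1) (t + 1),
              (max |1 - η k * α k| |1 - η k * β k| + η k * β k * ε k)) *
            ‖xb (i + 1) - xb i‖ := by
  refine le_prod_mul_add_sum_of_le_mul_add (e := fun t => ‖x t - xb t‖)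
    (c := fun i => max |1 - η i * α i| |1 - η i * β i| + η i * β i * ε i)
    (φ := fun t => ‖xb (t + 1) - xb t‖) (fun t => ?_) fun t => ?_
  · have := (hα t).le.trans (hαβ t)
    have := hε t
    have := (hη t).le
    positivity
  have hstable : ‖x (t + 1) - xb t‖ ≤
      ‖(x t - η t • g t (x t) (x t)) - (xb t - η t • g t (xb t) (xb t))‖ := by
    obtain ⟨h1, h2⟩ := hproj t (x t - η t • g t (x t) (x t))
    obtain ⟨h3, h4⟩ := hproj t (xb t - η t • g t (xb t) (xb t))
    have h5 := norm_sub_le_of_forall_norm_le (hCconv t) h1 h2 h3 h4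
    rwa [← hx t, ← hxb t] at h5
  have hsplit : (x t - η t • g t (x t) (x t)) - (xb t - η t • g t (xb t) (xb t)) =
      ((x t - η t • g t (x t) (xb t)) - (xb t - η t • g t (xb t) (xb t))) -
        η t • (g t (x t) (x t) - g t (x t) (xb t)) := by
    rw [smul_sub]; abel
  have hstep := norm_gradient_step_sub_le (η := η t) (hαβ t) (hgrad t (xb t)) (hsc t (xb t))
    (hglip t (xb t)) (xb t) (x t)
  have hshift : ‖η t • (g t (x t) (x t) - g t (x t) (xb t))‖ ≤
      η t * (β t * ε t * ‖x t - xb t‖) := by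
    rw [norm_smul, Real.norm_of_nonneg (hη t).le]
    exact mul_le_mul_of_nonneg_left (hsens t _ _ _) (hη t).le
  have htri := norm_sub_le
    ((x t - η t • g t (x t) (xb t)) - (xb t - η t • g t (xb t) (xb t)))
    (η t • (g t (x t) (x t) - g t (x t) (xb t)))
  rw [← hsplit] at htri
  have hdrift := norm_sub_le_norm_sub_add_norm_sub (x (t + 1)) (xb t) (xb (t + 1))
  rw [norm_sub_rev (xb t)] at hdrift
  linarith
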